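/- For every 3×3 real matrix A with Aᵀ * A = 1 and det A = 1 (i.e., every element of SO(3)), there exists a unit quaternion q ∈ ℍ with ‖q‖ = 1 such that M(q) = A. That is, the map M from the unit quaternions is surjective onto SO(3). -/

import Mathlib

/-- For a quaternion `a = x + y·i + z·j + w·k`, the associated `3 × 3` real matrix of the
rotation it induces on `ℝ³` (Rodrigues / Euler–Rodrigues formula). -/
noncomputable def quatToMatrix (a : Quaternion ℝ) : Matrix (Fin 3) (Fin 3) ℝ :=
  !![a.re ^ 2 + a.imI ^ 2 - a.imJ ^ 2 - a.imK ^ 2,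
      2 * (a.imI * a.imJ - a.re * a.imK),
      2 * (a.imI * a.imK + a.re * a.imJ);
    2 * (a.imI * a.imJ + a.re * a.imK),
      a.re ^ 2 - a.imI ^ 2 + a.imJ ^ 2 - a.imK ^ 2,
      2 * (a.imJ * a.imK - a.re * a.imI);
    2 * (a.imI * a.imK - a.re * a.imJ),
      2 * (a.imJ * a.imK + a.re * a.imI),
      a.re ^ 2 - a.imI ^ 2 - a.imJ ^ 2 + a.imK ^ 2]

open Matrix

/-- A matrix with positive trace whose `2 × 2` minors through a
diagonal entry vanish is of the form `v vᵀ`. -/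
theorem exists_mul_eq_of_minors_eq_zero {n : Type*} [Fintype n] (S : n → n → ℝ)
    (htr : 0 < ∑ i, S i i) (hS : ∀ k i j, S k i * S k j = S k k * S i j) :
    ∃ v : n → ℝ, ∀ i j, v i * v j = S i j := by
  obtain ⟨k, -, hk⟩ := Finset.exists_lt_of_sum_lt (s := Finset.univ) (f := fun _ => (0 : ℝ))
    (g := fun i => S i i) (by simpa using htr)
  refine ⟨fun i => S k i / √(S k k), fun i j => ?_⟩
  rw [div_mul_div_comm, Real.mul_self_sqrt hk.le, hS, mul_div_cancel_left₀ _ hk.ne']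

/-- For `A = quatToMatrix q` with `‖q‖ = 1`, the matrix of products of coordinates of `2 q`. -/
def quatProducts (A : Matrix (Fin 3) (Fin 3) ℝ) : Matrix (Fin 4) (Fin 4) ℝ :=
  !![1 + A 0 0 + A 1 1 + A 2 2, A 2 1 - A 1 2, A 0 2 - A 2 0, A 1 0 - A 0 1;
    A 2 1 - A 1 2, 1 + A 0 0 - A 1 1 - A 2 2, A 0 1 + A 1 0, A 0 2 + A 2 0;
    A 0 2 - A 2 0, A 0 1 + A 1 0, 1 - A 0 0 + A 1 1 - A 2 2, A 1 2 + A 2 1;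
    A 1 0 - A 0 1, A 0 2 + A 2 0, A 1 2 + A 2 1, 1 - A 0 0 - A 1 1 + A 2 2]

theorem quatProducts_minors (A : Matrix (Fin 3) (Fin 3) ℝ) (h1 : Aᵀ * A = 1) (h2 : A.det = 1)
    (k i j : Fin 4) :
    quatProducts A k i * quatProducts A k j = quatProducts A k k * quatProducts A i j := by
  have hrow : A * Aᵀ = 1 := mul_eq_one_comm.mp h1
  have hadj : A.adjugate = Aᵀ := by
    calc A.adjugate = Aᵀ * A * A.adjugate := by rw [h1, one_mul]
      _ = Aᵀ := by rw [Matrix.mul_assoc, mul_adjugate, h2, one_smul, mul_one]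
  have c (r s : Fin 3) := congrFun₂ h1 r s
  have d (r s : Fin 3) := congrFun₂ hrow r s
  have e (r s : Fin 3) := congrFun₂ hadj r s
  simp only [adjugate_fin_three, mul_apply, transpose_apply, Fin.sum_univ_three] at c d e
  simp only [Fin.forall_fin_succ, Fin.succ_zero_eq_one, Fin.succ_one_eq_two, IsEmpty.forall_iff,
    and_true] at c d e
  simp at c d e
  obtain ⟨⟨c00, c01, c02⟩, ⟨-, c11, c12⟩, -, -, c22⟩ := c
  obtain ⟨⟨d00, d01, d02⟩, ⟨-, d11, d12⟩, -, -, d22⟩ := d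
  obtain ⟨⟨e00, e01, e02⟩, ⟨e10, e11, e12⟩, e20, e21, e22⟩ := e
  fin_cases k <;> fin_cases i <;> fin_cases j <;> simp [quatProducts] <;> linarith

theorem Quaternion.norm_eq_one_iff_normSq_eq_one (q : Quaternion ℝ) :
    ‖q‖ = 1 ↔ Quaternion.normSq q = 1 := by
  rw [Quaternion.normSq_eq_norm_mul_self, ← sq, pow_eq_one_iff_of_nonneg (norm_nonneg q) two_ne_zero]

theorem stmt_18 (A : Matrix (Fin 3) (Fin 3) ℝ) (h1 : Aᵀ * A = 1) (h2 : A.det = 1) :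
    ∃ q : Quaternion ℝ, ‖q‖ = 1 ∧ quatToMatrix q = A := by
  obtain ⟨v, hv⟩ := exists_mul_eq_of_minors_eq_zero (quatProducts A)
    (by simp [quatProducts, Fin.sum_univ_four]; linarith) (quatProducts_minors A h1 h2)
  simp [Fin.forall_fin_succ, quatProducts] at hv
  obtain ⟨⟨v00, v01, v02, v03⟩, ⟨-, v11, v12, v13⟩, ⟨-, -, v22, v23⟩, -, -, -, v33⟩ := hv
  refine ⟨⟨v 0 / 2, v 1 / 2, v 2 / 2, v 3 / 2⟩, ?_, ?_⟩
  · refine (Quaternion.norm_eq_one_iff_normSq_eq_one _).mpr ?_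
    refine (Quaternion.normSq_def' _).trans ?_
    dsimp only
    linarith
  · ext i j
    fin_cases i <;> fin_cases j <;> simp [quatToMatrix] <;> linarith
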